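/- Let X be a topological space, A a topological space, φ : X × [0,∞) → X continuous, and C^g : X → [0,∞) lower semicontinuous, C^I : X × A → [0,∞) lower semicontinuous. Then the function (x, θ, a) ↦ ∫_{[0,θ]} C^g(φ(x,u)) du + 𝟙{θ < ∞}·C^I(φ(x,θ), a), defined on X × [0,∞] × A (where [0,∞] is the one-point compactification of [0,∞)), is lower semicontinuous. -/

import Mathlib

open scoped NNReal ENNReal

open MeasureTheory Filter Topology Set

/-- Cutting a nonnegative lower semicontinuous function off outside an open set keeps it lower
semicontinuous. -/
theorem LowerSemicontinuous.indicator_of_isOpen {α : Type*} [TopologicalSpace α] {f : α → ℝ≥0∞}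
    (hf : LowerSemicontinuous f) {s : Set α} (hs : IsOpen s) :
    LowerSemicontinuous (s.indicator f) := by
  intro x y hy
  by_cases hx : x ∈ s
  · rw [indicator_of_mem hx] at hy
    filter_upwards [hf x y hy, hs.mem_nhds hx] with z hz hzs
    rwa [indicator_of_mem hzs]
  · rw [indicator_of_notMem hx] at hy
    exact absurd hy not_lt_zero

/-- Fatou's lemma for parametric integrals: the integral of a family of functions that is lower
semicontinuous in the parameter is lower semicontinuous. -/
theorem lowerSemicontinuous_lintegral {α β : Type*} [TopologicalSpace α]
    [FirstCountableTopology α] [MeasurableSpace β] {μ : Measure β} {f : α → β → ℝ≥0∞}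
    (hm : ∀ x, Measurable (f x)) (hf : ∀ b, LowerSemicontinuous fun x => f x b) :
    LowerSemicontinuous fun x => ∫⁻ b, f x b ∂μ := by
  rw [lowerSemicontinuous_iff_le_liminf]
  intro x
  exact (lintegral_mono fun b => (hf b).le_liminf x).trans (lintegral_liminf_le hm)

/-- The integral over `[0, θ]` is the integral over `[0, ∞)` of the function cut off to
`[0, θ)`. -/
theorem setLIntegral_ofReal_le_eq_indicator (f : ℝ → ℝ≥0∞) (θ : ℝ≥0∞) :
    ∫⁻ u in {u : ℝ | 0 ≤ u ∧ ENNReal.ofReal u ≤ θ}, f u =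
      ∫⁻ u in Ici (0 : ℝ), {u : ℝ | ENNReal.ofReal u < θ}.indicator f u := by
  have hs : MeasurableSet {u : ℝ | ENNReal.ofReal u < θ} :=
    measurableSet_lt ENNReal.measurable_ofReal measurable_const
  rw [lintegral_indicator hs, Measure.restrict_restrict hs]
  refine setLIntegral_congr ?_
  filter_upwards [compl_mem_ae_iff.2 (measure_singleton (μ := volume) θ.toReal)] with u hu
  refine propext ⟨fun h => ⟨lt_of_le_of_ne h.2 ?_, h.1⟩, fun h => ⟨h.2, le_of_lt h.1⟩⟩
  rintro rfl
  exact hu (ENNReal.toReal_ofReal h.1).symm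

/-- For a continuous flow `φ : X × [0,∞) → X`, a lower semicontinuous running cost
rate `C^g : X → [0,∞)` and a lower semicontinuous impulse cost `C^I : X × A → [0,∞)`,
the function `(x, θ, a) ↦ ∫_{[0,θ]} C^g(φ(x,u)) du + 𝟙{θ < ∞}·C^I(φ(x,θ), a)` is
lower semicontinuous on `X × [0,∞] × A`; here `[0,∞]` (the one-point
compactification of `[0,∞)`) is modelled by `ℝ≥0∞`. -/
theorem stmt_12 {X A : Type*} [MetricSpace X] [MetricSpace A]
    (φ : X → ℝ → X)
    (hφ : ContinuousOn (fun p : X × ℝ => φ p.1 p.2) (Set.univ ×ˢ Set.Ici (0 : ℝ)))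
    (Cg : X → ℝ) (hCg : LowerSemicontinuous Cg) (hCg0 : ∀ x, 0 ≤ Cg x)
    (CI : X × A → ℝ) (hCI : LowerSemicontinuous CI) (hCI0 : ∀ p, 0 ≤ CI p) :
    LowerSemicontinuous (fun p : X × ℝ≥0∞ × A =>
      (∫⁻ u in {u : ℝ | 0 ≤ u ∧ ENNReal.ofReal u ≤ p.2.1},
          ENNReal.ofReal (Cg (φ p.1 u))) +
        (if p.2.1 ≠ ∞ then ENNReal.ofReal (CI (φ p.1 p.2.1.toReal, p.2.2)) else 0)) := by
  have hCg' : LowerSemicontinuous fun x => ENNReal.ofReal (Cg x) :=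
    ENNReal.continuous_ofReal.comp_lowerSemicontinuous hCg ENNReal.ofReal_mono
  have hCI' : LowerSemicontinuous fun p => ENNReal.ofReal (CI p) :=
    ENNReal.continuous_ofReal.comp_lowerSemicontinuous hCI ENNReal.ofReal_mono
  have hψ : Continuous fun p : X × ℝ => φ p.1 (max p.2 0) :=
    hφ.comp_continuous (f := fun p : X × ℝ => (p.1, max p.2 0)) (by fun_prop)
      fun p => ⟨mem_univ _, mem_Ici.2 (le_max_right p.2 0)⟩
  refine LowerSemicontinuous.add ?_ ?_
  · have key : LowerSemicontinuous fun p : X × ℝ≥0∞ × A => ∫⁻ u in Ici (0 : ℝ),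
        {u : ℝ | ENNReal.ofReal u < p.2.1}.indicator
          (fun u => ENNReal.ofReal (Cg (φ p.1 (max u 0)))) u := by
      refine lowerSemicontinuous_lintegral (fun p => ?_) fun u => ?_
      · refine Measurable.indicator ?_
          (measurableSet_lt ENNReal.measurable_ofReal measurable_const)
        exact (hCg'.comp (hψ.comp (Continuous.prodMk_right p.1))).measurable
      · have hopen : IsOpen {p : X × ℝ≥0∞ × A | ENNReal.ofReal u < p.2.1} :=
          isOpen_lt continuous_const (by fun_prop)
        exact (hCg'.comp (hψ.comp (by fun_prop :
          Continuous fun p : X × ℝ≥0∞ × A => (p.1, u)))).indicator_of_isOpen hopen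
    convert key using 2 with p
    rw [setLIntegral_ofReal_le_eq_indicator]
    refine setLIntegral_congr_fun measurableSet_Ici fun u hu => ?_
    simp only [indicator, max_eq_left (mem_Ici.1 hu)]
  · rintro ⟨x, θ, a⟩ y hy
    by_cases hθ : θ = ∞
    · simp [hθ] at hy
    · simp only [ne_eq, hθ, not_false_eq_true, if_true] at hy
      have hcont : ContinuousAt
          (fun p : X × ℝ≥0∞ × A => (φ p.1 (max p.2.1.toReal 0), p.2.2)) (x, θ, a) := by
        have h2 : ContinuousAt (fun p : X × ℝ≥0∞ × A => p.2.1.toReal) (x, θ, a) :=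
          ContinuousAt.comp (f := fun p : X × ℝ≥0∞ × A => p.2.1)
            (ENNReal.continuousAt_toReal hθ) (by fun_prop)
        have h1 : ContinuousAt (fun p : X × ℝ≥0∞ × A => (p.1, p.2.1.toReal)) (x, θ, a) :=
          continuousAt_fst.prodMk h2
        exact (hψ.continuousAt.comp h1).prodMk (by fun_prop)
      have hev := hcont.eventually (hCI' _ y (by simpa using hy))
      have hfin : ∀ᶠ p : X × ℝ≥0∞ × A in 𝓝 (x, θ, a), p.2.1 ≠ ∞ :=
        (by fun_prop : ContinuousAt (fun p : X × ℝ≥0∞ × A => p.2.1) (x, θ, a)).eventually_ne hθ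
      filter_upwards [hev, hfin] with p hp hpθ
      simpa [hpθ] using hp
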